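/- For every k ≥ 1, the following identity of formal power series in z with coefficients in ℤ[x_1,…,x_k,t] holds: D(x,t,z) · Σ_{n≥1} W̃_n(x,t) z^n = Σ_{i≥1} i·t^{i−1} e_i(x) z^i, where W̃_n(x,t) := Σ_w t^{cdes(w)} x_w, the sum over all Smirnov words w of length n over [k]. Consequently, each W̃_n(x,t) is symmetric in x_1,…,x_k and e-positive. -/

import Mathlib

open Finset MvPolynomial Polynomial

attribute [local instance] Classical.propDecidable

noncomputable section

/-- The descent number of a word `w = w₁⋯wₙ` over the alphabet `[k]`:
the number of indices `i ∈ [n-1]` with `wᵢ > wᵢ₊₁`. -/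
def desc {n k : ℕ} (w : Fin n → Fin k) : ℕ :=
  (Finset.univ.filter fun i : Fin n =>
    ∃ h : (i : ℕ) + 1 < n, w ⟨(i : ℕ) + 1, h⟩ < w i).card

/-- The cyclic descent number: the number of indices `i ∈ [n]` with `wᵢ > wᵢ₊₁`,
where `wₙ₊₁ := w₁`. -/
def cdesc {n k : ℕ} (w : Fin n → Fin k) : ℕ :=
  (Finset.univ.filter fun i : Fin n =>
    w ⟨((i : ℕ) + 1) % n, Nat.mod_lt _ i.pos⟩ < w i).card

/-- A word is Smirnov if no two adjacent letters are equal. -/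
def IsSmirnov {n k : ℕ} (w : Fin n → Fin k) : Prop :=
  ∀ i : Fin n, ∀ h : (i : ℕ) + 1 < n, w ⟨(i : ℕ) + 1, h⟩ ≠ w i

/-- the first letter is strictly smaller than the last letter -/
def FirstLtLast {n k : ℕ} (w : Fin n → Fin k) : Prop :=
  ∃ h : 0 < n, w ⟨0, h⟩ < w ⟨n - 1, Nat.sub_lt h Nat.one_pos⟩

/-- the first letter is strictly larger than the last letter -/
def FirstGtLast {n k : ℕ} (w : Fin n → Fin k) : Prop :=
  ∃ h : 0 < n, w ⟨n - 1, Nat.sub_lt h Nat.one_pos⟩ < w ⟨0, h⟩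

/-- the first letter equals the last letter -/
def FirstEqLast {n k : ℕ} (w : Fin n → Fin k) : Prop :=
  ∃ h : 0 < n, w ⟨0, h⟩ = w ⟨n - 1, Nat.sub_lt h Nat.one_pos⟩

/-- the first letter differs from the last letter -/
def FirstNeLast {n k : ℕ} (w : Fin n → Fin k) : Prop :=
  ∃ h : 0 < n, w ⟨0, h⟩ ≠ w ⟨n - 1, Nat.sub_lt h Nat.one_pos⟩

/-- the monomial `x_w = x_{w₁}⋯x_{wₙ}` -/
def xw (R : Type) [CommRing R] {n k : ℕ} (w : Fin n → Fin k) : MvPolynomial (Fin k) R :=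
  ∏ i, MvPolynomial.X (w i)

/-- Generic restricted Smirnov word enumerator: the sum of `t^(stat w) · x_w` over all
Smirnov words `w` of length `n` over `[k]` satisfying `P`, as a polynomial in `t`
with coefficients in `R[x₁,…,x_k]`. -/
def smirnovEnum (R : Type) [CommRing R] (n k : ℕ) (stat : (Fin n → Fin k) → ℕ)
    (P : (Fin n → Fin k) → Prop) : Polynomial (MvPolynomial (Fin k) R) :=
  ∑ w ∈ Finset.univ.filter (fun w : Fin n → Fin k => IsSmirnov w ∧ P w),
    Polynomial.X ^ stat w * Polynomial.C (xw R w)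

/-- the t-analogue `[m]_t = 1 + t + ⋯ + t^(m-1)`, as a polynomial in `t = Polynomial.X`
with coefficients in `R[x₁,…,x_k]` -/
def tnum (R : Type) [CommRing R] (k m : ℕ) : Polynomial (MvPolynomial (Fin k) R) :=
  ∑ j ∈ Finset.range m, Polynomial.X ^ j

/-- `D(x,t,z) = 1 - Σ_{i≥2} t[i-1]_t e_i(x) z^i`, a formal power series in `z` whose
coefficients are polynomials in `t` with coefficients in `R[x₁,…,x_k]`. -/
def Dser (R : Type) [CommRing R] (k : ℕ) : PowerSeries (Polynomial (MvPolynomial (Fin k) R)) :=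
  PowerSeries.mk fun i =>
    if i = 0 then 1
    else if i = 1 then 0
    else -(Polynomial.X * tnum R k (i - 1) * Polynomial.C (esymm (Fin k) R i))

/-- e-positivity of a symmetric polynomial in `x₁,…,x_k` (no `t`): it is a nonnegative
combination of products `e_λ = e_{λ₁}⋯e_{λ_ℓ}` over partitions `λ` (multisets of positive
integers). -/
def EPosX (R : Type) [CommRing R] [PartialOrder R] {k : ℕ} (P : MvPolynomial (Fin k) R) : Prop :=
  ∃ (S : Finset (Multiset ℕ)) (c : Multiset ℕ → R),
    (∀ μ ∈ S, ∀ i ∈ μ, 0 < i) ∧ (∀ μ ∈ S, 0 ≤ c μ) ∧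
    P = ∑ μ ∈ S, MvPolynomial.C (c μ) * (μ.map (esymm (Fin k) R)).prod

/-- e-positivity of a polynomial in `t` with coefficients in `R[x₁,…,x_k]`:
`P = Σ_λ c_λ(t) e_λ(x)` over partitions `λ`, where each `c_λ(t)` has nonnegative
coefficients. -/
def EPosT (R : Type) [CommRing R] [PartialOrder R] {k : ℕ}
    (P : Polynomial (MvPolynomial (Fin k) R)) : Prop :=
  ∃ (S : Finset (Multiset ℕ)) (c : Multiset ℕ → Polynomial R),
    (∀ μ ∈ S, ∀ i ∈ μ, 0 < i) ∧ (∀ μ ∈ S, ∀ j, 0 ≤ (c μ).coeff j) ∧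
    P = ∑ μ ∈ S, ((c μ).map (MvPolynomial.C : R →+* MvPolynomial (Fin k) R)) *
          Polynomial.C ((μ.map (esymm (Fin k) R)).prod)

/-- `P`, a polynomial in `t` with coefficients in `R[x₁,…,x_k]`, is symmetric in
`x₁,…,x_k`. -/
def SymmX (R : Type) [CommRing R] {k : ℕ} (P : Polynomial (MvPolynomial (Fin k) R)) : Prop :=
  ∀ j : ℕ, (P.coeff j).IsSymmetric

/-- coefficients of `-D` -/
def cc {S : Type*} [CommRing S] (t : S) : ℕ → S
  | 0 => -1
  | n + 1 => t * ∑ j ∈ Finset.range n, t ^ j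

lemma cc_mul {S : Type*} [CommRing S] (t : S) (n : ℕ) : (1 - t) * cc t n = t - t ^ n := by
  cases n with
  | zero => simp [cc]
  | succ n =>
    have := mul_neg_geom_sum t n
    simp only [cc]
    linear_combination t * this

lemma cc_sub {S : Type*} [CommRing S] (t : S) (n : ℕ) : cc t (n + 1) - cc t n = t ^ n := by
  cases n with
  | zero => simp [cc]
  | succ n =>
    simp only [cc, Finset.sum_range_succ]
    ring

/-- transfer matrix -/
def MM {S : Type*} [CommRing S] (k : ℕ) (t : S) : Matrix (Fin k) (Fin k) S :=
  Matrix.of fun a b => if a < b then 1 else if b < a then t else 0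

/-- `D` evaluated -/
def DD {S : Type*} [CommRing S] {k : ℕ} (t : S) (y : Fin k → S) : S :=
  -∑ T : Finset (Fin k), cc t T.card * ∏ i ∈ T, y i

lemma DD_mul {S : Type*} [CommRing S] {k : ℕ} (t : S) (y : Fin k → S) :
    (1 - t) * DD t y = ∏ i, (1 + t * y i) - t * ∏ i, (1 + y i) := by
  rw [Finset.prod_one_add, Finset.prod_one_add, DD, Finset.mul_sum, mul_neg, Finset.mul_sum,
    Finset.powerset_univ, ← Finset.sum_sub_distrib, ← Finset.sum_neg_distrib]
  refine Finset.sum_congr rfl fun T _ => ?_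
  rw [← mul_assoc, cc_mul, Finset.prod_mul_distrib, Finset.prod_const]
  ring

lemma rank_one {S : Type*} [CommRing S] {k : ℕ} (A : Matrix (Fin k) (Fin k) S)
    (hA : IsUnit A.det) (u : Fin k → S) : ∃ c : S, ∀ l : S,
    (A + Matrix.of fun a _ => l * u a).det = A.det + l * c := by
  let v : Fin k → S := fun _ => 1
  refine ⟨A.det * (Matrix.replicateRow Unit v * A⁻¹ *
    Matrix.replicateCol Unit u : Matrix Unit Unit S) () (), fun l => ?_⟩
  have h := Matrix.det_add_replicateCol_mul_replicateRow (ι := Unit) hA (l • u) v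
  have h2 : (Matrix.of fun a _ => l * u a : Matrix (Fin k) (Fin k) S) =
      Matrix.replicateCol Unit (l • u) * Matrix.replicateRow Unit v := by
    ext a b
    simp [v, Matrix.mul_apply]
  rw [h2, h, Matrix.det_unique (n := Unit)]
  simp only [Matrix.replicateCol_smul, Matrix.mul_smul, Matrix.add_apply, Matrix.smul_apply]
  simp
  ring

lemma det_eq {S : Type*} [CommRing S] [IsDomain S] {k : ℕ} (t : S) (ht : 1 - t ≠ 0)
    (y : Fin k → S) (hA : IsUnit (1 - Matrix.diagonal y * MM k t).det) :
    (1 - Matrix.diagonal y * MM k t).det = DD t y := by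
  obtain ⟨c, hc⟩ := rank_one _ hA y
  have h1 := hc 1
  have h2 := hc t
  rw [Matrix.det_of_isLowerTriangular] at h1
  · rw [Matrix.det_of_isUpperTriangular] at h2
    · have e1 : ∏ i, ((1 - Matrix.diagonal y * MM k t) +
        Matrix.of fun a _ => (1 : S) * y a : Matrix (Fin k) (Fin k) S) i i = ∏ i, (1 + y i) := by
        refine Finset.prod_congr rfl fun i _ => ?_
        simp [MM]
      have e2 : ∏ i, ((1 - Matrix.diagonal y * MM k t) +
        Matrix.of fun a _ => t * y a : Matrix (Fin k) (Fin k) S) i i = ∏ i, (1 + t * y i) := by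
        refine Finset.prod_congr rfl fun i _ => ?_
        simp [MM]
      rw [e1] at h1
      rw [e2] at h2
      apply mul_left_cancel₀ ht
      rw [DD_mul, h1, h2]
      ring
    · intro a b hab
      replace hab : b < a := hab
      simp [MM, hab, hab.ne', hab.not_gt]
      ring
  · intro a b hab
    replace hab : a < b := hab
    simp [MM, hab, hab.ne, hab.not_gt]

lemma adj_eq {S : Type*} [CommRing S] {k : ℕ} (t : S) (y : Fin k → S) (a : Fin k) :
    (1 - Matrix.diagonal y * MM k t).adjugate a a =
      (1 - Matrix.diagonal (Function.update y a 0) * MM k t).det := by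
  rw [Matrix.adjugate_apply]
  congr 1
  ext i j
  by_cases h : i = a
  · subst h
    simp [Matrix.one_apply, Pi.single_apply, eq_comm]
  · simp [Matrix.updateRow_ne h, h]

lemma prod_update_zero {S : Type*} [CommRing S] {k : ℕ} (y : Fin k → S) (a : Fin k)
    (T : Finset (Fin k)) :
    ∏ i ∈ T, Function.update y a 0 i = if a ∈ T then 0 else ∏ i ∈ T, y i := by
  split_ifs with h
  · exact Finset.prod_eq_zero h (by simp)
  · exact Finset.prod_congr rfl fun i hi => by
      rw [Function.update_of_ne]; rintro rfl; exact h hi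

lemma sum_DD {S : Type*} [CommRing S] {k : ℕ} (t : S) (y : Fin k → S) :
    ∑ a, DD t (Function.update y a 0) - k * DD t y =
      ∑ T : Finset (Fin k), T.card * cc t T.card * ∏ i ∈ T, y i := by
  simp only [DD, prod_update_zero, Finset.sum_neg_distrib]
  rw [Finset.sum_comm, mul_neg, Finset.mul_sum, sub_neg_eq_add, neg_add_eq_sub,
    ← Finset.sum_sub_distrib]
  refine Finset.sum_congr rfl fun T _ => ?_
  have : ∑ x : Fin k, cc t T.card * (if x ∈ T then 0 else ∏ i ∈ T, y i) =
    ∑ x : Fin k, (cc t T.card * (∏ i ∈ T, y i) - if x ∈ T then cc t T.card * (∏ i ∈ T, y i) else 0) := by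
    refine Finset.sum_congr rfl fun x _ => ?_
    split_ifs <;> simp
  rw [this, Finset.sum_sub_distrib]
  simp
  ring

lemma sum_y_DD {S : Type*} [CommRing S] {k : ℕ} (t : S) (y : Fin k → S) :
    ∑ a, y a * DD t (Function.update y a 0) =
      -∑ T : Finset (Fin k), T.card * cc t (T.card - 1) * ∏ i ∈ T, y i := by
  simp only [DD, prod_update_zero, mul_neg, Finset.sum_neg_distrib, Finset.mul_sum]
  congr 1
  have h1 : ∀ a : Fin k, ∑ T : Finset (Fin k),
      y a * (cc t T.card * if a ∈ T then 0 else ∏ i ∈ T, y i) =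
      ∑ T : Finset (Fin k), if a ∈ T then cc t (T.card - 1) * ∏ i ∈ T, y i else 0 := by
    intro a
    have e1 : ∀ T : Finset (Fin k), y a * (cc t T.card * if a ∈ T then 0 else ∏ i ∈ T, y i) =
      if a ∉ T then y a * (cc t T.card * ∏ i ∈ T, y i) else 0 := by
      intro T
      by_cases h : a ∈ T <;> simp [h]
    simp only [e1]
    rw [← Finset.sum_filter, ← Finset.sum_filter]
    refine Finset.sum_bij' (fun T _ => insert a T) (fun T _ => T.erase a) ?_ ?_ ?_ ?_ ?_
    · intro T hT; simp
    · intro T hT; simp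
    · intro T hT; simp at hT; simp [hT]
    · intro T hT; simp at hT; simp [hT]
    · intro T hT
      simp at hT
      rw [Finset.prod_insert hT, Finset.card_insert_of_notMem hT]
      simp
      ring
  simp only [h1]
  rw [Finset.sum_comm]
  refine Finset.sum_congr rfl fun T _ => ?_
  rw [← Finset.sum_filter]
  simp
  ring

lemma sum_total {S : Type*} [CommRing S] {k : ℕ} (t : S) (y : Fin k → S) :
    ∑ a, DD t (Function.update y a 0) - k * DD t y + ∑ a, y a * DD t (Function.update y a 0) =
      ∑ T : Finset (Fin k), T.card * t ^ (T.card - 1) * ∏ i ∈ T, y i := by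
  rw [sum_DD, sum_y_DD, ← sub_eq_add_neg, ← Finset.sum_sub_distrib]
  refine Finset.sum_congr rfl fun T _ => ?_
  rcases h : T.card with _ | n
  · simp
  · rw [Nat.add_sub_cancel, ← cc_sub t n]
    ring

lemma pow_words {S : Type*} [CommRing S] {k : ℕ} (N : Matrix (Fin k) (Fin k) S) (m : ℕ)
    (a : Fin k) (f : Fin k → S) :
    ∑ b, (N ^ m) a b * f b = ∑ w : Fin m → Fin k,
      (∏ i : Fin m, N ((Fin.cons a w : Fin (m + 1) → Fin k) i.castSucc)
        ((Fin.cons a w : Fin (m + 1) → Fin k) i.succ)) *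
        f ((Fin.cons a w : Fin (m + 1) → Fin k) (Fin.last m)) := by
  induction m generalizing a with
  | zero => simp [Matrix.one_apply]
  | succ m ih =>
    rw [← (Fin.consEquiv (fun _ : Fin (m + 1) => Fin k)).sum_comp, Fintype.sum_prod_type]
    simp only [pow_succ', Matrix.mul_apply, Finset.sum_mul]
    rw [Finset.sum_comm]
    refine Finset.sum_congr rfl fun c _ => ?_
    simp only [mul_assoc]
    rw [← Finset.mul_sum, ih, Finset.mul_sum]
    refine Finset.sum_congr rfl fun v _ => ?_
    rw [Fin.prod_univ_succ]
    simp only [Fin.consEquiv, Equiv.coe_fn_mk, ← Fin.succ_castSucc, Fin.cons_succ, Fin.castSucc_zero,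
      Fin.cons_zero, ← Fin.succ_last, mul_assoc]

lemma trace_words {S : Type*} [CommRing S] {k : ℕ} (N F : Matrix (Fin k) (Fin k) S) (m : ℕ) :
    (N ^ m * F).trace = ∑ w : Fin (m + 1) → Fin k,
      (∏ i : Fin m, N (w i.castSucc) (w i.succ)) * F (w (Fin.last m)) (w 0) := by
  rw [← (Fin.consEquiv (fun _ : Fin (m + 1) => Fin k)).sum_comp, Fintype.sum_prod_type]
  simp only [Matrix.trace, Matrix.diag, Matrix.mul_apply]
  refine Finset.sum_congr rfl fun a _ => ?_
  rw [pow_words N m a (fun b => F b a)]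
  rfl

lemma cdesc_succ {m k : ℕ} (w : Fin (m + 1) → Fin k) :
    cdesc w = (∑ i : Fin m, if w i.succ < w i.castSucc then 1 else 0) +
      if w 0 < w (Fin.last m) then 1 else 0 := by
  rw [cdesc, Finset.card_filter, Fin.sum_univ_castSucc]
  congr 1
  · refine Finset.sum_congr rfl fun i _ => ?_
    have : (⟨((i.castSucc : Fin (m + 1)) + 1 : ℕ) % (m + 1), Nat.mod_lt _ (Nat.succ_pos m)⟩ : Fin (m + 1))
        = i.succ := by
      ext
      simp [Nat.mod_eq_of_lt]
    rw [this]
  · have : (⟨((Fin.last m : Fin (m + 1)) + 1 : ℕ) % (m + 1), Nat.mod_lt _ (Nat.succ_pos m)⟩ : Fin (m + 1))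
        = 0 := by
      ext
      simp
    rw [this]

lemma smirnov_succ {m k : ℕ} (w : Fin (m + 1) → Fin k) :
    IsSmirnov w ↔ ∀ i : Fin m, w i.succ ≠ w i.castSucc := by
  constructor
  · intro h i
    exact h i.castSucc (by simp)
  · intro h i hi
    exact h ⟨i, by omega⟩

lemma MM_ne {S : Type*} [CommRing S] {k : ℕ} (t : S) (a b : Fin k) (h : b ≠ a) :
    MM k t a b = t ^ (if b < a then 1 else 0) := by
  rcases lt_or_gt_of_ne h with h | h
  · simp [MM, h, h.not_gt]
  · simp [MM, h, h.not_gt]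

lemma MM_add {S : Type*} [CommRing S] {k : ℕ} (t : S) (a b : Fin k) :
    (MM k t + 1) a b = t ^ (if b < a then 1 else 0) := by
  by_cases h : b = a
  · subst h
    simp [MM]
  · rw [Matrix.add_apply, MM_ne t a b h, Matrix.one_apply_ne (Ne.symm h), add_zero]

lemma weight_word {m k : ℕ} (w : Fin (m + 1) → Fin k) :
    (∏ i : Fin m, (Matrix.diagonal (fun a => Polynomial.C (MvPolynomial.X a)) *
      MM k (Polynomial.X : Polynomial (MvPolynomial (Fin k) ℤ)) : Matrix (Fin k) (Fin k) (Polynomial (MvPolynomial (Fin k) ℤ))) (w i.castSucc) (w i.succ)) *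
      (Matrix.diagonal (fun a => Polynomial.C (MvPolynomial.X a)) *
      (MM k (Polynomial.X : Polynomial (MvPolynomial (Fin k) ℤ)) + 1) : Matrix (Fin k) (Fin k) (Polynomial (MvPolynomial (Fin k) ℤ))) (w (Fin.last m)) (w 0) =
    if IsSmirnov w then Polynomial.X ^ cdesc w * Polynomial.C (xw ℤ w) else 0 := by
  simp only [Matrix.diagonal_mul, MM_add]
  by_cases h : IsSmirnov w
  · rw [if_pos h]
    rw [smirnov_succ] at h
    rw [Finset.prod_mul_distrib, Finset.prod_congr rfl fun i _ => MM_ne _ _ _ (h i),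
      Finset.prod_pow_eq_pow_sum, cdesc_succ, xw, map_prod, Fin.prod_univ_castSucc,
      pow_add]
    ring
  · rw [if_neg h]
    rw [smirnov_succ] at h
    push Not at h
    obtain ⟨i, hi⟩ := h
    rw [Finset.prod_eq_zero (Finset.mem_univ i), zero_mul]
    rw [hi]
    simp [MM]

lemma enum_eq (m k : ℕ) : smirnovEnum ℤ (m + 1) k cdesc (fun _ => True) =
    ((Matrix.diagonal (fun a => Polynomial.C (MvPolynomial.X a)) *
      MM k (Polynomial.X : Polynomial (MvPolynomial (Fin k) ℤ))) ^ m *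
      (Matrix.diagonal (fun a => Polynomial.C (MvPolynomial.X a)) *
      (MM k (Polynomial.X : Polynomial (MvPolynomial (Fin k) ℤ)) + 1))).trace := by
  rw [trace_words]
  simp only [weight_word]
  rw [smirnovEnum, Finset.sum_filter]
  simp

/-- resolvent -/
def GG {S : Type*} [CommRing S] {k : ℕ} (N : Matrix (Fin k) (Fin k) S) :
    Matrix (Fin k) (Fin k) (PowerSeries S) :=
  Matrix.of fun a b => PowerSeries.mk fun n => (N ^ n) a b

lemma GG_eq {S : Type*} [CommRing S] {k : ℕ} (N : Matrix (Fin k) (Fin k) S) :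
    (1 - (PowerSeries.X : PowerSeries S) • N.map (PowerSeries.C)) * GG N = 1 := by
  rw [sub_mul, one_mul, Matrix.smul_mul, sub_eq_iff_eq_add]
  ext a b n
  rw [Matrix.add_apply, Matrix.smul_apply, map_add, smul_eq_mul]
  cases n with
  | zero =>
    simp [GG, Matrix.one_apply]
  | succ n =>
    rw [PowerSeries.coeff_succ_X_mul]
    simp only [GG, Matrix.mul_apply, Matrix.of_apply, PowerSeries.coeff_mk, pow_succ', map_sum, Matrix.map_apply,
      PowerSeries.coeff_C_mul, Matrix.one_apply]
    split_ifs <;> simp [PowerSeries.coeff_one]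

lemma det_unit {S : Type*} [CommRing S] {k : ℕ} (y : Fin k → PowerSeries S) (t : PowerSeries S)
    (hy : ∀ a, PowerSeries.constantCoeff (y a) = 0) :
    IsUnit (1 - Matrix.diagonal y * MM k t).det := by
  rw [PowerSeries.isUnit_iff_constantCoeff, RingHom.map_det]
  have : (PowerSeries.constantCoeff (R := S)).mapMatrix (1 - Matrix.diagonal y * MM k t) = 1 := by
    rw [map_sub, map_one, map_mul]
    have : (PowerSeries.constantCoeff (R := S)).mapMatrix (Matrix.diagonal y) = 0 := by
      ext a b
      simp [Matrix.diagonal_apply]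
      split_ifs <;> simp [hy]
    rw [this]
    simp
  rw [this]
  simp

lemma W_eq (k : ℕ) :
    PowerSeries.mk (fun n => if n = 0 then 0 else smirnovEnum ℤ n k cdesc (fun _ => True)) =
    (GG (Matrix.diagonal (fun a => Polynomial.C (MvPolynomial.X a)) *
      MM k (Polynomial.X : Polynomial (MvPolynomial (Fin k) ℤ))) *
      ((PowerSeries.X : PowerSeries (Polynomial (MvPolynomial (Fin k) ℤ))) •
        (Matrix.diagonal (fun a => Polynomial.C (MvPolynomial.X a)) *
      (MM k (Polynomial.X : Polynomial (MvPolynomial (Fin k) ℤ)) + 1)).map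
        (PowerSeries.C))).trace := by
  ext1 n
  rw [Matrix.mul_smul, Matrix.trace_smul, smul_eq_mul]
  cases n with
  | zero => simp
  | succ n =>
    rw [PowerSeries.coeff_succ_X_mul, PowerSeries.coeff_mk, if_neg (Nat.succ_ne_zero n), enum_eq]
    simp only [Matrix.trace, Matrix.diag, map_sum]
    refine Finset.sum_congr rfl fun a _ => ?_
    rw [Matrix.mul_apply, Matrix.mul_apply, map_sum]
    refine Finset.sum_congr rfl fun b _ => ?_
    rw [Matrix.map_apply, PowerSeries.coeff_mul_C]
    simp [GG]

/-- the variables `x_a z` -/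
def yy (k : ℕ) (a : Fin k) : PowerSeries (Polynomial (MvPolynomial (Fin k) ℤ)) :=
  PowerSeries.X * PowerSeries.C (Polynomial.C (MvPolynomial.X a))

lemma prod_yy (k : ℕ) (T : Finset (Fin k)) : ∏ i ∈ T, yy k i =
    PowerSeries.C (Polynomial.C (∏ i ∈ T, MvPolynomial.X i)) * PowerSeries.X ^ T.card := by
  simp only [yy, Finset.prod_mul_distrib, Finset.prod_const, map_prod]
  ring

lemma coeff_sum_yy (k : ℕ) (g : ℕ → Polynomial (MvPolynomial (Fin k) ℤ)) (n : ℕ) :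
    PowerSeries.coeff n (∑ T : Finset (Fin k), PowerSeries.C (g T.card) * ∏ i ∈ T, yy k i) =
      g n * Polynomial.C (esymm (Fin k) ℤ n) := by
  simp only [prod_yy, ← mul_assoc, ← map_mul, map_sum, PowerSeries.coeff_C_mul_X_pow]
  rw [esymm, map_sum, Finset.mul_sum, ← Finset.sum_filter]
  refine Finset.sum_congr ?_ ?_
  · ext T
    simp [Finset.mem_powersetCard, eq_comm]
  · intro T hT
    simp at hT
    rw [hT]

lemma map_MM {S S' : Type*} [CommRing S] [CommRing S'] (k : ℕ) (f : S →+* S') (t : S) :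
    (MM k t).map f = MM k (f t) := by
  ext a b
  simp only [MM, Matrix.map_apply, Matrix.of_apply]
  split_ifs <;> simp

lemma smul_map_eq (k : ℕ) (M : Matrix (Fin k) (Fin k) (Polynomial (MvPolynomial (Fin k) ℤ))) :
    (PowerSeries.X : PowerSeries (Polynomial (MvPolynomial (Fin k) ℤ))) •
        (Matrix.diagonal (fun a => Polynomial.C (MvPolynomial.X a)) * M).map
        (PowerSeries.C) = Matrix.diagonal (yy k) * M.map (PowerSeries.C) := by
  ext1 a b
  simp [yy, mul_assoc]

lemma cc_map {S S' : Type*} [CommRing S] [CommRing S'] (f : S →+* S') (t : S) (n : ℕ) :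
    cc (f t) n = f (cc t n) := by
  cases n <;> simp [cc]

lemma Dser_eq (k : ℕ) : Dser ℤ k = DD (PowerSeries.C Polynomial.X) (yy k) := by
  ext1 n
  simp only [DD, cc_map]
  rw [map_neg, coeff_sum_yy k (fun n => cc Polynomial.X n), Dser, PowerSeries.coeff_mk]
  rcases n with _ | _ | n
  · simp [cc]
  · simp [cc]
  · simp [cc, tnum]

lemma gf_identity (k : ℕ) : Dser ℤ k *
      PowerSeries.mk (fun n => if n = 0 then 0 else smirnovEnum ℤ n k cdesc (fun _ => True)) =
    PowerSeries.mk (fun i =>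
      if 1 ≤ i then
        (i : Polynomial (MvPolynomial (Fin k) ℤ)) * Polynomial.X ^ (i - 1) *
          Polynomial.C (esymm (Fin k) ℤ i)
      else 0) := by
  set t : PowerSeries (Polynomial (MvPolynomial (Fin k) ℤ)) := PowerSeries.C Polynomial.X with ht
  have ht1 : 1 - t ≠ 0 := by
    intro h
    rw [sub_eq_zero, ht, ← map_one (PowerSeries.C)] at h
    have h2 := congrArg (fun p => Polynomial.coeff p 0) (PowerSeries.C_injective h)
    simp at h2
  have hdet : (1 - Matrix.diagonal (yy k) * MM k t).det = DD t (yy k) :=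
    det_eq t ht1 _ (det_unit _ _ fun a => by simp [yy])
  have hadj : ∀ a, (1 - Matrix.diagonal (yy k) * MM k t).adjugate a a =
      DD t (Function.update (yy k) a 0) := fun a => by
    rw [adj_eq]
    refine det_eq t ht1 _ (det_unit _ _ fun b => ?_)
    by_cases h : b = a
    · subst h; simp
    · simp [h, yy]
  have hG := GG_eq (Matrix.diagonal (fun a => Polynomial.C (MvPolynomial.X a)) *
      MM k (Polynomial.X : Polynomial (MvPolynomial (Fin k) ℤ)))
  rw [smul_map_eq, map_MM] at hG
  rw [W_eq, smul_map_eq, Dser_eq, ← ht, ← hdet, ← smul_eq_mul, ← Matrix.trace_smul,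
    ← Matrix.smul_mul]
  have hG2 : (1 - Matrix.diagonal (yy k) * MM k t).det • GG (Matrix.diagonal
      (fun a => Polynomial.C (MvPolynomial.X a)) *
      MM k (Polynomial.X : Polynomial (MvPolynomial (Fin k) ℤ))) =
      (1 - Matrix.diagonal (yy k) * MM k t).adjugate := by
    have h7 := congrArg ((1 - Matrix.diagonal (yy k) * MM k t).adjugate * ·) hG
    simp only [← mul_assoc, mul_one, ← ht] at h7
    rw [Matrix.adjugate_mul, Matrix.smul_mul, one_mul] at h7
    exact h7
  have hM : (MM k (Polynomial.X : Polynomial (MvPolynomial (Fin k) ℤ)) + 1).map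
      (PowerSeries.C) = MM k t + 1 := by
    rw [Matrix.map_add _ (map_add _), map_MM, Matrix.map_one _ (map_zero _) (map_one _)]
  rw [hG2, hM, mul_add, mul_one]
  have h3 : (1 - Matrix.diagonal (yy k) * MM k t).adjugate *
      (Matrix.diagonal (yy k) * MM k t) = (1 - Matrix.diagonal (yy k) * MM k t).adjugate -
      DD t (yy k) • 1 := by
    rw [← hdet, ← Matrix.adjugate_mul, mul_sub]
    simp
  rw [mul_add, h3, Matrix.trace_add, Matrix.trace_sub, Matrix.trace_smul, Matrix.trace_one]
  have h4 : (1 - Matrix.diagonal (yy k) * MM k t).adjugate.trace =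
      ∑ a, DD t (Function.update (yy k) a 0) := Finset.sum_congr rfl fun a _ => hadj a
  have h5 : ((1 - Matrix.diagonal (yy k) * MM k t).adjugate * Matrix.diagonal (yy k)).trace =
      ∑ a, yy k a * DD t (Function.update (yy k) a 0) :=
    Finset.sum_congr rfl fun a _ => by
      rw [Matrix.diag_apply, Matrix.mul_diagonal, hadj, mul_comm]
  rw [h4, h5, Fintype.card_fin, smul_eq_mul, mul_comm (DD t (yy k)), sum_total]
  ext1 n
  have h6 : ∀ T : Finset (Fin k), (T.card : PowerSeries (Polynomial (MvPolynomial (Fin k) ℤ))) *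
      t ^ (T.card - 1) * ∏ i ∈ T, yy k i =
      PowerSeries.C ((T.card : Polynomial (MvPolynomial (Fin k) ℤ)) *
        Polynomial.X ^ (T.card - 1)) * ∏ i ∈ T, yy k i := by
    intro T
    simp [ht]
  rw [Finset.sum_congr rfl fun T _ => h6 T,
    coeff_sum_yy k (fun n => (n : Polynomial (MvPolynomial (Fin k) ℤ)) * Polynomial.X ^ (n - 1)),
    PowerSeries.coeff_mk]
  rcases n with _ | n <;> simp

lemma EPosT_zero {k : ℕ} : EPosT ℤ (0 : Polynomial (MvPolynomial (Fin k) ℤ)) :=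
  ⟨∅, 0, by simp, by simp, by simp⟩

lemma EPosT_add {k : ℕ} {P Q : Polynomial (MvPolynomial (Fin k) ℤ)} (hP : EPosT ℤ P)
    (hQ : EPosT ℤ Q) : EPosT ℤ (P + Q) := by
  obtain ⟨S, c, h1, h2, h3⟩ := hP
  obtain ⟨S', c', h1', h2', h3'⟩ := hQ
  refine ⟨S ∪ S', fun μ => (if μ ∈ S then c μ else 0) + (if μ ∈ S' then c' μ else 0), ?_, ?_, ?_⟩
  · intro μ hμ
    rcases Finset.mem_union.1 hμ with h | h
    · exact h1 μ h
    · exact h1' μ h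
  · intro μ _ j
    rw [Polynomial.coeff_add]
    apply add_nonneg
    · split_ifs with h
      · exact h2 μ h j
      · simp
    · split_ifs with h
      · exact h2' μ h j
      · simp
  · simp only [Polynomial.map_add, add_mul, Finset.sum_add_distrib]
    rw [h3, h3']
    congr 1
    · rw [← Finset.sum_subset (Finset.subset_union_left (s₁ := S) (s₂ := S'))]
      · exact Finset.sum_congr rfl fun μ hμ => by rw [if_pos hμ]
      · intro μ _ hμ
        simp [hμ]
    · rw [← Finset.sum_subset (Finset.subset_union_right (s₁ := S) (s₂ := S'))]
      · exact Finset.sum_congr rfl fun μ hμ => by rw [if_pos hμ]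
      · intro μ _ hμ
        simp [hμ]

lemma EPosT_sum {k : ℕ} {ι : Type*} (s : Finset ι)
    (P : ι → Polynomial (MvPolynomial (Fin k) ℤ)) (h : ∀ i ∈ s, EPosT ℤ (P i)) :
    EPosT ℤ (∑ i ∈ s, P i) :=
  Finset.sum_induction P (EPosT ℤ) (fun _ _ => EPosT_add) EPosT_zero h

lemma nonneg_mul (p q : Polynomial ℤ) (hp : ∀ j, 0 ≤ p.coeff j) (hq : ∀ j, 0 ≤ q.coeff j) (j : ℕ) :
    0 ≤ (p * q).coeff j := by
  rw [Polynomial.coeff_mul]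
  exact Finset.sum_nonneg fun x _ => mul_nonneg (hp _) (hq _)

lemma EPosT_mul {k : ℕ} {P : Polynomial (MvPolynomial (Fin k) ℤ)} (hP : EPosT ℤ P)
    (p : Polynomial ℤ) (hp : ∀ j, 0 ≤ p.coeff j) (i : ℕ) (hi : 0 < i) :
    EPosT ℤ (p.map (MvPolynomial.C : ℤ →+* MvPolynomial (Fin k) ℤ) *
      Polynomial.C (esymm (Fin k) ℤ i) * P) := by
  obtain ⟨S, c, h1, h2, h3⟩ := hP
  refine ⟨S.image (fun μ => i ::ₘ μ), fun μ => p * c (μ.erase i), ?_, ?_, ?_⟩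
  · intro μ hμ j hj
    obtain ⟨ν, hν, rfl⟩ := Finset.mem_image.1 hμ
    rcases Multiset.mem_cons.1 hj with rfl | h
    · exact hi
    · exact h1 ν hν j h
  · intro μ hμ j
    obtain ⟨ν, hν, rfl⟩ := Finset.mem_image.1 hμ
    refine nonneg_mul _ _ hp ?_ j
    have := h2 ν hν
    simpa using this
  · rw [Finset.sum_image (by intro a _ b _ h; simpa using h), h3, Finset.mul_sum]
    refine Finset.sum_congr rfl fun μ _ => ?_
    simp only [Multiset.erase_cons_head, Polynomial.map_mul, Multiset.map_cons, Multiset.prod_cons,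
      map_mul]
    ring

lemma EPosT_one {k : ℕ} : EPosT ℤ (1 : Polynomial (MvPolynomial (Fin k) ℤ)) := by
  refine ⟨{0}, fun _ => 1, by simp, ?_, by simp⟩
  intro _ _ j
  rw [Polynomial.coeff_one]
  split_ifs <;> simp

lemma SymmX_of_EPosT {k : ℕ} {P : Polynomial (MvPolynomial (Fin k) ℤ)} (hP : EPosT ℤ P) :
    SymmX ℤ P := by
  obtain ⟨S, c, -, -, rfl⟩ := hP
  intro j
  rw [Polynomial.finsetSum_coeff]
  change _ ∈ MvPolynomial.symmetricSubalgebra (Fin k) ℤ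
  refine Subalgebra.sum_mem _ fun μ _ => ?_
  rw [Polynomial.coeff_mul_C, Polynomial.coeff_map]
  refine Subalgebra.mul_mem _ ?_ ?_
  · exact MvPolynomial.IsSymmetric.C _
  · refine Subalgebra.multiset_prod_mem _ ?_
    intro x hx
    obtain ⟨i, _, rfl⟩ := Multiset.mem_map.1 hx
    exact MvPolynomial.esymm_isSymmetric _ _ _

lemma nonneg_X_pow (i j : ℕ) : 0 ≤ (Polynomial.X ^ i : Polynomial ℤ).coeff j := by
  rw [Polynomial.coeff_X_pow]
  split_ifs <;> simp

lemma enum_EPosT (k n : ℕ) (hn : 1 ≤ n) : EPosT ℤ (smirnovEnum ℤ n k cdesc (fun _ => True)) := by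
  induction n using Nat.strong_induction_on with
  | _ n ih =>
  have h := congrArg (PowerSeries.coeff n) (gf_identity k)
  rw [PowerSeries.coeff_mul, PowerSeries.coeff_mk, if_pos hn] at h
  obtain ⟨m, rfl⟩ : ∃ m, n = m + 1 := ⟨n - 1, by omega⟩
  rw [Finset.Nat.sum_antidiagonal_succ] at h
  simp only [PowerSeries.coeff_mk, Dser] at h
  rw [if_pos trivial, if_neg (Nat.succ_ne_zero m), one_mul, ← eq_sub_iff_add_eq, sub_eq_add_neg,
    ← Finset.sum_neg_distrib] at h
  rw [h]
  refine EPosT_add ?_ (EPosT_sum _ _ ?_)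
  · have := EPosT_mul (k := k) EPosT_one (((m + 1 : ℕ) : Polynomial ℤ) * Polynomial.X ^ (m + 1 - 1)) ?_ (m + 1) hn
    · simpa using this
    · intro j
      rw [← Polynomial.C_eq_natCast, Polynomial.coeff_C_mul]
      exact mul_nonneg (by positivity) (nonneg_X_pow _ _)
  · rintro ⟨a, b⟩ hab
    rw [Finset.HasAntidiagonal.mem_antidiagonal] at hab
    simp only at hab ⊢
    by_cases hb : b = 0
    · simpa [hb] using EPosT_zero
    by_cases ha : a = 0
    · simpa [ha] using EPosT_zero
    rw [if_neg hb, if_neg (Nat.succ_ne_zero a), if_neg (by omega)]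
    have := EPosT_mul (ih b (by omega) (by omega))
      (Polynomial.X * ∑ j ∈ Finset.range a, Polynomial.X ^ j) ?_ (a + 1) (Nat.succ_pos a)
    · convert this using 1
      simp only [tnum, Polynomial.map_mul, Polynomial.map_sum, Polynomial.map_pow, Polynomial.map_X,
        Nat.add_sub_cancel]
      ring
    · intro j
      refine nonneg_mul _ _ ?_ ?_ j
      · intro j
        simpa using nonneg_X_pow 1 j
      · intro j
        rw [Polynomial.finsetSum_coeff]
        exact Finset.sum_nonneg fun i _ => nonneg_X_pow i j

/-- `D(x,t,z) · Σ_{n≥1} W̃_n(x,t) z^n = Σ_{i≥1} i·t^{i-1} e_i(x) z^i`;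
consequently each `W̃_n(x,t)` is symmetric in `x₁,…,x_k` and e-positive. -/
theorem smirnov_cyclic_enumerator (k : ℕ) (hk : 1 ≤ k) :
    (Dser ℤ k *
      PowerSeries.mk (fun n => if n = 0 then 0 else smirnovEnum ℤ n k cdesc (fun _ => True)) =
    PowerSeries.mk (fun i =>
      if 1 ≤ i then
        (i : Polynomial (MvPolynomial (Fin k) ℤ)) * Polynomial.X ^ (i - 1) *
          Polynomial.C (esymm (Fin k) ℤ i)
      else 0)) ∧
    ∀ n : ℕ, 1 ≤ n →
      SymmX ℤ (smirnovEnum ℤ n k cdesc (fun _ => True)) ∧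
      EPosT ℤ (smirnovEnum ℤ n k cdesc (fun _ => True)) := by
  exact ⟨gf_identity k, fun n hn => ⟨SymmX_of_EPosT (enum_EPosT k n hn), enum_EPosT k n hn⟩⟩

end
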